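/- arXiv:2407.21722 — 3 statements merged into one kernel-verified Lean document; each statement's English description precedes it below -/
import Mathlib

section
/- Let j ∈ ℤ, A ≥ 0 and f ∈ E_A. If n > A and m > An/(n−A) (which for n > A is equivalent to mn/(m+n) > A), then the composition of the operators satisfies (S_{m,j}(S_{n,j} f))(x) = (S_{mn/(m+n), j} f)(x) for all x ≥ 0. -/
open MeasureTheory Real Filter Asymptotics

/-- The basis functions `s_{n,k}(x) = (nx)^k / k! · e^{-nx}` for `k ≥ 0`, and `0` for `k < 0`. -/
noncomputable def szk (n : ℝ) (k : ℤ) (x : ℝ) : ℝ :=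
  if k < 0 then 0 else (n * x) ^ k.toNat / (Nat.factorial k.toNat) * Real.exp (-n * x)

/-- Membership in `E_A`: locally integrable on `[0,∞)` and `|f t| ≤ K e^{A t}` for some `K > 0`. -/
def MemEA (A : ℝ) (f : ℝ → ℝ) : Prop :=
  LocallyIntegrableOn f (Set.Ici 0) volume ∧ ∃ K > 0, ∀ t ≥ (0:ℝ), |f t| ≤ K * Real.exp (A * t)

/-- The Szász-Mirakjan-Durrmeyer type operator `S_{n,j}`. -/
noncomputable def Snj (n : ℝ) (j : ℤ) (f : ℝ → ℝ) (x : ℝ) : ℝ :=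
  f 0 * ∑ k ∈ Finset.range j.toNat, szk n k x
    + ∑' k : ℕ, szk n (max 0 j + k) x *
        (n * ∫ t in Set.Ioi (0:ℝ), szk n (max 0 j + k - j) t * f t)


open scoped ENNReal

/-- The Poisson weight `y ^ k / k! · e^{-y}`. -/
noncomputable def poissonWeight (k : ℕ) (y : ℝ) : ℝ :=
  y ^ k / (Nat.factorial k) * Real.exp (-y)

lemma poissonWeight_nonneg (k : ℕ) {y : ℝ} (hy : 0 ≤ y) : 0 ≤ poissonWeight k y := by
  unfold poissonWeight; positivity

lemma poissonWeight_le_one (k : ℕ) {y : ℝ} (hy : 0 ≤ y) : poissonWeight k y ≤ 1 := by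
  unfold poissonWeight
  rw [Real.exp_neg, ← div_eq_mul_inv, div_le_one (Real.exp_pos _)]
  exact Real.pow_div_factorial_le_exp y hy k

@[fun_prop]
lemma measurable_poissonWeight (k : ℕ) : Measurable (poissonWeight k) := by
  unfold poissonWeight; fun_prop

lemma hasSum_pow_div_factorial_exp (y : ℝ) :
    HasSum (fun k : ℕ => y ^ k / (Nat.factorial k)) (Real.exp y) := by
  rw [Real.exp_eq_exp_ℝ]
  exact NormedSpace.expSeries_div_hasSum_exp y

lemma hasSum_poissonWeight (y : ℝ) : HasSum (fun k => poissonWeight k y) 1 := by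
  have h := (hasSum_pow_div_factorial_exp y).mul_right (Real.exp (-y))
  rwa [← Real.exp_add, add_neg_cancel, Real.exp_zero] at h

lemma szk_natCast (n : ℝ) (k : ℕ) (x : ℝ) : szk n k x = poissonWeight k (n * x) := by
  simp [szk, poissonWeight]

lemma lintegral_pow_mul_exp_neg_mul (k : ℕ) {c : ℝ} (hc : 0 < c) :
    ∫⁻ t in Set.Ioi (0 : ℝ), ENNReal.ofReal (t ^ k * Real.exp (-(c * t))) =
      ENNReal.ofReal ((Nat.factorial k) / c ^ (k + 1)) := by
  have hI : IntegrableOn (fun t : ℝ => t ^ k * Real.exp (-(c * t))) (Set.Ioi 0) := by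
    have := integrableOn_rpow_mul_exp_neg_mul_rpow (p := 1) (s := k) (b := c)
      (by have : (0 : ℝ) ≤ k := k.cast_nonneg
          linarith) one_pos hc
    simpa [Real.rpow_natCast, neg_mul] using this
  have hv := Real.integral_rpow_mul_exp_neg_mul_Ioi (a := k + 1) (r := c) (by positivity) hc
  simp only [add_sub_cancel_right, Real.rpow_natCast, Real.Gamma_nat_eq_factorial] at hv
  rw [← ofReal_integral_eq_lintegral_ofReal hI, hv]
  · congr 1
    rw [show ((k : ℝ) + 1) = ((k + 1 : ℕ) : ℝ) by push_cast; ring, Real.rpow_natCast]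
    rw [one_div, inv_pow]; ring
  · filter_upwards [ae_restrict_mem measurableSet_Ioi] with t ht
    have : 0 < t := ht
    simp only [Pi.zero_apply]; positivity

lemma lintegral_poissonWeight_mul_exp (k : ℕ) {n A : ℝ} (hn : 0 ≤ n) (h : A < n) :
    ∫⁻ t in Set.Ioi (0 : ℝ), ENNReal.ofReal (poissonWeight k (n * t) * Real.exp (A * t)) =
      ENNReal.ofReal (n ^ k / (n - A) ^ (k + 1)) := by
  have e : ∀ t : ℝ, ENNReal.ofReal (poissonWeight k (n * t) * Real.exp (A * t)) =
      ENNReal.ofReal (n ^ k / (Nat.factorial k)) *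
        ENNReal.ofReal (t ^ k * Real.exp (-((n - A) * t))) := by
    intro t
    rw [← ENNReal.ofReal_mul (by positivity)]
    congr 1
    rw [poissonWeight, mul_assoc, ← Real.exp_add, mul_pow,
      show -(n * t) + A * t = -((n - A) * t) by ring]
    ring
  have hc : 0 < n - A := by linarith
  simp_rw [e]
  rw [lintegral_const_mul _ (by fun_prop), lintegral_pow_mul_exp_neg_mul k hc,
    ← ENNReal.ofReal_mul (by positivity)]
  congr 1
  field_simp

lemma cast_choose_mul_factorial_mul_factorial (c d : ℕ) :
    ((c + d).choose c : ℝ) * (Nat.factorial c) * (Nat.factorial d) = (Nat.factorial (c + d)) := by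
  rw [Nat.choose_symm_add]
  exact_mod_cast Nat.add_choose_mul_factorial_mul_factorial c d

lemma lintegral_poissonWeight_mul_poissonWeight (c d : ℕ) {m n : ℝ} (hm : 0 < m) (hn : 0 < n) :
    ∫⁻ y in Set.Ioi (0 : ℝ), ENNReal.ofReal (poissonWeight c (m * y) * poissonWeight d (n * y)) =
      ENNReal.ofReal ((c + d).choose c * m ^ c * n ^ d / (m + n) ^ (c + d + 1)) := by
  have e : ∀ y : ℝ, ENNReal.ofReal (poissonWeight c (m * y) * poissonWeight d (n * y)) =
      ENNReal.ofReal (m ^ c * n ^ d / ((Nat.factorial c) * (Nat.factorial d))) *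
        ENNReal.ofReal (y ^ (c + d) * Real.exp (-((m + n) * y))) := by
    intro y
    rw [← ENNReal.ofReal_mul (by positivity)]
    congr 1
    rw [poissonWeight, poissonWeight, show -((m + n) * y) = -(m * y) + -(n * y) by ring,
      Real.exp_add, mul_pow, mul_pow, pow_add]
    field_simp
  simp_rw [e]
  rw [lintegral_const_mul _ (by fun_prop), lintegral_pow_mul_exp_neg_mul _ (add_pos hm hn),
    ← ENNReal.ofReal_mul (by positivity)]
  congr 1
  rw [← cast_choose_mul_factorial_mul_factorial]
  field_simp

lemma poissonWeight_thinning (a k : ℕ) {p q u : ℝ} (hp : 0 ≤ p) (hq : 0 ≤ q) (hpq : p + q = 1)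
    (hu : 0 ≤ u) :
    ENNReal.ofReal (poissonWeight (a + k) (q * u)) =
      ∑' i : ℕ, ENNReal.ofReal
        ((a + i).choose (a + k) * q ^ (a + k) * p ^ (i - k) * poissonWeight (a + i) u) := by
  have hs : HasSum (fun s : ℕ => ((a + (s + k)).choose (a + k) : ℝ) * q ^ (a + k) *
      p ^ (s + k - k) * poissonWeight (a + (s + k)) u) (poissonWeight (a + k) (q * u)) := by
    have h := (hasSum_pow_div_factorial_exp (p * u)).mul_left
      ((q * u) ^ (a + k) / (Nat.factorial (a + k)) * Real.exp (-u))
    have hval : (q * u) ^ (a + k) / (Nat.factorial (a + k)) * Real.exp (-u) * Real.exp (p * u) =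
        poissonWeight (a + k) (q * u) := by
      rw [poissonWeight, mul_assoc, ← Real.exp_add]
      congr 2
      linear_combination u * hpq
    rw [hval] at h
    refine Eq.subst (motive := fun F => HasSum F _) (funext fun s => ?_) h
    rw [Nat.add_sub_cancel, poissonWeight, show a + (s + k) = a + k + s by ring,
      ← cast_choose_mul_factorial_mul_factorial (a + k) s]
    have hch : ((a + k + s).choose (a + k) : ℝ) ≠ 0 := by
      exact_mod_cast (Nat.choose_pos (Nat.le_add_right _ _)).ne'
    rw [mul_pow, mul_pow]
    field_simp
    ring
  have hnn : ∀ i : ℕ, 0 ≤ ((a + i).choose (a + k) : ℝ) * q ^ (a + k) *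
      p ^ (i - k) * poissonWeight (a + i) u := fun i => by
    have := poissonWeight_nonneg (a + i) hu
    positivity
  have hs' := (hasSum_nat_add_iff (f := fun i : ℕ => ((a + i).choose (a + k) : ℝ) * q ^ (a + k) *
      p ^ (i - k) * poissonWeight (a + i) u) k).1 hs
  rw [Finset.sum_eq_zero, add_zero] at hs'
  · rw [← ENNReal.ofReal_tsum_of_nonneg hnn hs'.summable, hs'.tsum_eq]
  · intro i hi
    rw [Nat.choose_eq_zero_of_lt (by have := Finset.mem_range.1 hi; omega)]
    simp

lemma sum_choose_mul_choose (a b i h : ℕ) (hab : a = 0 ∨ b = 0) :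
    ∑ k ∈ Finset.range (i + 1), (a + i).choose (a + k) * (b + h).choose (b + k) =
      ((b + i) + (a + h)).choose (b + i) := by
  have hlow : ∀ s ∈ Finset.range b, (b + h).choose s * (a + i).choose (b + i - s) = 0 := by
    intro s hs
    have := Finset.mem_range.1 hs
    rw [Nat.choose_eq_zero_of_lt (show a + i < b + i - s by omega), mul_zero]
  rw [show b + i + (a + h) = (b + h) + (a + i) by ring, Nat.add_choose_eq,
    Finset.Nat.sum_antidiagonal_eq_sum_range_succ_mk, Nat.succ_eq_add_one, add_assoc b i 1,
    Finset.sum_range_add _ b (i + 1), Finset.sum_eq_zero hlow, zero_add]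
  refine Finset.sum_congr rfl fun k hk => ?_
  have := Finset.mem_range.1 hk
  rw [mul_comm, ← Nat.choose_symm_of_eq_add (show a + i = (b + i - (b + k)) + (a + k) by omega)]

/-- The kernel of the integral part of the Durrmeyer operator with `j = a - b`. -/
noncomputable def durrKernel (a b : ℕ) (n x t : ℝ) : ℝ≥0∞ :=
  ∑' i : ℕ, ENNReal.ofReal (n * poissonWeight (a + i) (n * x) * poissonWeight (b + i) (n * t))

lemma measurable_durrKernel (a b : ℕ) (n : ℝ) :
    Measurable fun z : ℝ × ℝ => durrKernel a b n z.1 z.2 := by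
  unfold durrKernel
  exact Measurable.tsum fun i => by fun_prop

lemma measurable_durrKernel_right (a b : ℕ) (n x : ℝ) :
    Measurable fun t => durrKernel a b n x t := by
  unfold durrKernel
  exact Measurable.tsum fun i => by fun_prop

lemma measurable_durrKernel_left (a b : ℕ) (n t : ℝ) :
    Measurable fun x => durrKernel a b n x t := by
  unfold durrKernel
  exact Measurable.tsum fun i => by fun_prop

lemma durrKernel_ne_top (a b : ℕ) {n x t : ℝ} (hn : 0 ≤ n) (hx : 0 ≤ x) (ht : 0 ≤ t) :
    durrKernel a b n x t ≠ ∞ := by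
  refine Summable.tsum_ofReal_ne_top (Summable.of_nonneg_of_le (fun i => ?_) (fun i => ?_)
    (((hasSum_poissonWeight (n * x)).summable.comp_injective
      (add_right_injective a)).mul_left n))
  · have := poissonWeight_nonneg (a + i) (mul_nonneg hn hx)
    have := poissonWeight_nonneg (b + i) (mul_nonneg hn ht)
    positivity
  · have := poissonWeight_nonneg (a + i) (mul_nonneg hn hx)
    exact mul_le_of_le_one_right (by positivity) (poissonWeight_le_one _ (mul_nonneg hn ht))

lemma sum_thinning_coeff (a b i h : ℕ) (hab : a = 0 ∨ b = 0) (p q : ℝ) :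
    ∑ k ∈ Finset.range (i + 1), (((a + i).choose (a + k) : ℝ) * q ^ (a + k) * p ^ (i - k)) *
        (((b + h).choose (b + k) : ℝ) * p ^ (b + k) * q ^ (h - k)) =
      ((b + i) + (a + h)).choose (b + i) * p ^ (b + i) * q ^ (a + h) := by
  rw [← sum_choose_mul_choose a b i h hab]
  push_cast
  rw [mul_assoc, Finset.sum_mul]
  refine Finset.sum_congr rfl fun k hk => ?_
  have hki := Finset.mem_range.1 hk
  rcases le_or_gt k h with hkh | hkh
  · obtain ⟨s, rfl⟩ := Nat.exists_eq_add_of_le (show k ≤ i by omega)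
    obtain ⟨r, rfl⟩ := Nat.exists_eq_add_of_le hkh
    simp only [Nat.add_sub_cancel_left]
    ring
  · rw [Nat.choose_eq_zero_of_lt (show b + h < b + k by omega)]
    simp

lemma lintegral_durrKernel_mul_durrKernel {a b : ℕ} (hab : a = 0 ∨ b = 0) {m n x t : ℝ}
    (hm : 0 < m) (hn : 0 < n) (hx : 0 ≤ x) (ht : 0 ≤ t) :
    ∫⁻ y in Set.Ioi (0 : ℝ), durrKernel a b m x y * durrKernel a b n y t =
      durrKernel a b (m * n / (m + n)) x t := by
  have hmn : 0 < m + n := add_pos hm hn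
  set p := m / (m + n) with hp
  set q := n / (m + n) with hq
  have hp0 : 0 < p := by positivity
  have hq0 : 0 < q := by positivity
  have hpq : p + q = 1 := by rw [hp, hq]; field_simp
  have hu : 0 ≤ m * x := by positivity
  have hv : 0 ≤ n * t := by positivity
  have hU : ∀ i, 0 ≤ poissonWeight (a + i) (m * x) := fun i => poissonWeight_nonneg _ hu
  have hV : ∀ i, 0 ≤ poissonWeight (b + i) (n * t) := fun i => poissonWeight_nonneg _ hv
  have hL : ∫⁻ y in Set.Ioi (0 : ℝ), durrKernel a b m x y * durrKernel a b n y t =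
      ∑' i : ℕ, ∑' h : ℕ, ENNReal.ofReal (n * p * (((b + i) + (a + h)).choose (b + i) *
        p ^ (b + i) * q ^ (a + h)) *
        (poissonWeight (a + i) (m * x) * poissonWeight (b + h) (n * t))) := by
    simp only [durrKernel, ← ENNReal.tsum_mul_right, ← ENNReal.tsum_mul_left]
    rw [ENNReal.tsum_comm,
      lintegral_tsum fun h => (Measurable.tsum fun i => by fun_prop).aemeasurable]
    refine tsum_congr fun h => ?_
    rw [lintegral_tsum fun i => by fun_prop]
    refine tsum_congr fun i => ?_
    have e : ∀ y ∈ Set.Ioi (0 : ℝ), ENNReal.ofReal (m * poissonWeight (a + i) (m * x) *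
          poissonWeight (b + i) (m * y)) *
        ENNReal.ofReal (n * poissonWeight (a + h) (n * y) * poissonWeight (b + h) (n * t)) =
        ENNReal.ofReal (m * n * (poissonWeight (a + i) (m * x) * poissonWeight (b + h) (n * t))) *
        ENNReal.ofReal (poissonWeight (b + i) (m * y) * poissonWeight (a + h) (n * y)) := by
      intro y hy
      have := hU i
      have := hV h
      have hy : 0 < y := hy
      have := poissonWeight_nonneg (b + i) (mul_nonneg hm.le hy.le)
      rw [← ENNReal.ofReal_mul (by positivity), ← ENNReal.ofReal_mul (by positivity)]
      congr 1; ring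
    have := hU i
    have := hV h
    rw [setLIntegral_congr_fun measurableSet_Ioi e, lintegral_const_mul _ (by fun_prop),
      lintegral_poissonWeight_mul_poissonWeight _ _ hm hn, ← ENNReal.ofReal_mul (by positivity)]
    congr 1
    rw [hp, hq, div_pow, div_pow, pow_succ, pow_add (m + n)]
    field_simp
  rw [hL]
  symm
  have hterm : ∀ k : ℕ, ENNReal.ofReal (m * n / (m + n) *
      poissonWeight (a + k) (m * n / (m + n) * x) * poissonWeight (b + k) (m * n / (m + n) * t)) =
      ∑' i : ℕ, ∑' h : ℕ, ENNReal.ofReal (n * p *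
        ((((a + i).choose (a + k) : ℝ) * q ^ (a + k) * p ^ (i - k)) *
        (((b + h).choose (b + k) : ℝ) * p ^ (b + k) * q ^ (h - k))) *
        (poissonWeight (a + i) (m * x) * poissonWeight (b + h) (n * t))) := by
    intro k
    rw [show m * n / (m + n) * x = q * (m * x) by rw [hq]; ring,
      show m * n / (m + n) * t = p * (n * t) by rw [hp]; ring,
      show m * n / (m + n) = n * p by rw [hp]; ring]
    have h1 := poissonWeight_nonneg (a + k) (mul_nonneg hq0.le hu)
    rw [ENNReal.ofReal_mul (by positivity), ENNReal.ofReal_mul (by positivity),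
      poissonWeight_thinning a k hp0.le hq0.le hpq hu,
      poissonWeight_thinning b k hq0.le hp0.le (by linarith) hv]
    simp only [← ENNReal.tsum_mul_right, ← ENNReal.tsum_mul_left]
    rw [ENNReal.tsum_comm]
    refine tsum_congr fun i => tsum_congr fun h => ?_
    have := hU i
    have := hV h
    rw [← ENNReal.ofReal_mul (by positivity), ← ENNReal.ofReal_mul (by positivity)]
    congr 1; ring
  unfold durrKernel
  simp_rw [hterm]
  rw [ENNReal.tsum_comm]
  refine tsum_congr fun i => ?_
  rw [ENNReal.tsum_comm]
  refine tsum_congr fun h => ?_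
  have := hU i
  have := hV h
  rw [tsum_eq_sum (s := Finset.range (i + 1)), ← ENNReal.ofReal_sum_of_nonneg,
    ← sum_thinning_coeff a b i h hab, Finset.mul_sum, Finset.sum_mul]
  · intro k _
    positivity
  · intro k hk
    rw [Nat.choose_eq_zero_of_lt (by have := mt Finset.mem_range.2 hk; omega)]
    simp

lemma enorm_toReal_durrKernel_mul (a b : ℕ) {n x t : ℝ} (hn : 0 ≤ n) (hx : 0 ≤ x) (ht : 0 ≤ t)
    (c : ℝ) : ‖(durrKernel a b n x t).toReal * c‖ₑ = durrKernel a b n x t * ‖c‖ₑ := by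
  rw [enorm_mul, Real.enorm_of_nonneg ENNReal.toReal_nonneg,
    ENNReal.ofReal_toReal (durrKernel_ne_top a b hn hx ht)]

lemma integrable_durrKernel_mul {a b : ℕ} {n x : ℝ} {f : ℝ → ℝ} (hn : 0 ≤ n) (hx : 0 ≤ x)
    (hf : AEStronglyMeasurable f (volume.restrict (Set.Ioi 0)))
    (hfin : ∫⁻ t in Set.Ioi (0 : ℝ), durrKernel a b n x t * ‖f t‖ₑ ≠ ∞) :
    IntegrableOn (fun t => (durrKernel a b n x t).toReal * f t) (Set.Ioi 0) := by
  have hk := measurable_durrKernel_right a b n x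
  refine ⟨hk.ennreal_toReal.aestronglyMeasurable.mul hf, ?_⟩
  rw [hasFiniteIntegral_iff_enorm, setLIntegral_congr_fun measurableSet_Ioi fun t ht =>
    enorm_toReal_durrKernel_mul a b hn hx (le_of_lt ht) (f t)]
  exact hfin.lt_top

/-- The integral part of the Durrmeyer operator with `j = a - b`. -/
noncomputable def durrPart (a b : ℕ) (n : ℝ) (f : ℝ → ℝ) (x : ℝ) : ℝ :=
  ∑' i : ℕ, poissonWeight (a + i) (n * x) *
    (n * ∫ t in Set.Ioi (0 : ℝ), poissonWeight (b + i) (n * t) * f t)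

lemma durrPart_congr (a b : ℕ) (n x : ℝ) {f g : ℝ → ℝ} (h : ∀ t > 0, f t = g t) :
    durrPart a b n f x = durrPart a b n g x := by
  unfold durrPart
  refine tsum_congr fun i => ?_
  rw [setIntegral_congr_fun measurableSet_Ioi fun t ht => by rw [h t ht]]

lemma durrPart_eq_integral {a b : ℕ} {n x : ℝ} {f : ℝ → ℝ} (hn : 0 ≤ n) (hx : 0 ≤ x)
    (hf : AEStronglyMeasurable f (volume.restrict (Set.Ioi 0)))
    (hfin : ∫⁻ t in Set.Ioi (0 : ℝ), durrKernel a b n x t * ‖f t‖ₑ ≠ ∞) :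
    durrPart a b n f x = ∫ t in Set.Ioi (0 : ℝ), (durrKernel a b n x t).toReal * f t := by
  have hnn : ∀ i, ∀ t ∈ Set.Ioi (0 : ℝ),
      0 ≤ n * poissonWeight (a + i) (n * x) * poissonWeight (b + i) (n * t) := fun i t ht =>
    mul_nonneg (mul_nonneg hn (poissonWeight_nonneg _ (mul_nonneg hn hx)))
      (poissonWeight_nonneg _ (mul_nonneg hn (le_of_lt ht)))
  have hker : ∀ t ∈ Set.Ioi (0 : ℝ), (durrKernel a b n x t).toReal * f t =
      ∑' i, n * poissonWeight (a + i) (n * x) * poissonWeight (b + i) (n * t) * f t := by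
    intro t ht
    rw [tsum_mul_right, durrKernel, ENNReal.tsum_toReal_eq fun i => ENNReal.ofReal_ne_top]
    simp_rw [ENNReal.toReal_ofReal (hnn _ t ht)]
  rw [setIntegral_congr_fun measurableSet_Ioi hker, integral_tsum]
  · refine tsum_congr fun i => ?_
    simp_rw [mul_assoc]
    rw [integral_const_mul, integral_const_mul]
    ring
  · intro i
    have : Measurable fun t => n * poissonWeight (a + i) (n * x) * poissonWeight (b + i) (n * t) :=
      by fun_prop
    exact this.aestronglyMeasurable.mul hf
  · rw [← lintegral_tsum]
    · convert hfin using 1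
      refine setLIntegral_congr_fun measurableSet_Ioi fun t ht => ?_
      simp only [durrKernel, ← ENNReal.tsum_mul_right]
      refine tsum_congr fun i => ?_
      rw [enorm_mul, Real.enorm_of_nonneg (hnn i t ht)]
    · intro i
      have : Measurable fun t =>
        n * poissonWeight (a + i) (n * x) * poissonWeight (b + i) (n * t) := by fun_prop
      exact (this.aestronglyMeasurable.mul hf).enorm

lemma lintegral_durrKernel_mul_enorm_ne_top (a b : ℕ) {n x A K : ℝ} {f : ℝ → ℝ} (hn : 0 ≤ n)
    (hx : 0 ≤ x) (hnA : A < n) (hK : ∀ t ≥ (0 : ℝ), |f t| ≤ K * Real.exp (A * t)) :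
    ∫⁻ t in Set.Ioi (0 : ℝ), durrKernel a b n x t * ‖f t‖ₑ ≠ ∞ := by
  have hK0 : 0 ≤ K := by simpa using (abs_nonneg _).trans (hK 0 le_rfl)
  have hw : ∀ i, 0 ≤ poissonWeight (a + i) (n * x) := fun i =>
    poissonWeight_nonneg _ (mul_nonneg hn hx)
  have hc : 0 < n - A := by linarith
  have hle : ∫⁻ t in Set.Ioi (0 : ℝ), durrKernel a b n x t * ‖f t‖ₑ ≤
      ∑' i, ENNReal.ofReal (K * n * poissonWeight (a + i) (n * x) *
        (n ^ (b + i) / (n - A) ^ (b + i + 1))) := by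
    have hb : ∀ t ∈ Set.Ioi (0 : ℝ), durrKernel a b n x t * ‖f t‖ₑ ≤
        ∑' i, ENNReal.ofReal (K * n * poissonWeight (a + i) (n * x)) *
          ENNReal.ofReal (poissonWeight (b + i) (n * t) * Real.exp (A * t)) := by
      intro t ht
      rw [durrKernel, ← ENNReal.tsum_mul_right]
      refine ENNReal.tsum_le_tsum fun i => ?_
      have h1 := hw i
      have h2 := poissonWeight_nonneg (b + i) (mul_nonneg hn (le_of_lt ht))
      rw [← ofReal_norm, Real.norm_eq_abs, ← ENNReal.ofReal_mul (by positivity),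
        ← ENNReal.ofReal_mul (by positivity)]
      refine ENNReal.ofReal_le_ofReal ?_
      refine (mul_le_mul_of_nonneg_left (hK t (le_of_lt ht)) (by positivity)).trans_eq ?_
      ring
    refine (setLIntegral_mono' measurableSet_Ioi hb).trans_eq ?_
    rw [lintegral_tsum fun i => by fun_prop]
    refine tsum_congr fun i => ?_
    have h1 := hw i
    rw [lintegral_const_mul _ (by fun_prop), lintegral_poissonWeight_mul_exp _ hn hnA,
      ← ENNReal.ofReal_mul (by positivity)]
  refine ne_top_of_le_ne_top (Summable.tsum_ofReal_ne_top ?_) hle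
  have hs := ((Real.summable_pow_div_factorial (n * x * (n / (n - A)))).comp_injective
    (add_right_injective a)).mul_left
    (K * n * Real.exp (-(n * x)) * (n ^ b / (n - A) ^ (b + 1)) * ((n - A) / n) ^ a)
  rcases hn.eq_or_lt with rfl | hn
  · simp [summable_zero]
  refine hs.congr fun i => ?_
  simp only [Function.comp_apply, poissonWeight]
  rw [mul_pow _ (n / (n - A)), pow_add (n / (n - A)), div_pow, div_pow, div_pow]
  rw [show b + i + 1 = b + 1 + i by ring, pow_add (n - A) (b + 1), pow_add n b]
  field_simp

lemma aestronglyMeasurable_durrKernel_mul (a b : ℕ) (n : ℝ) {f : ℝ → ℝ}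
    (hf : AEStronglyMeasurable f (volume.restrict (Set.Ioi 0))) :
    AEStronglyMeasurable (fun z : ℝ × ℝ => (durrKernel a b n z.1 z.2).toReal * f z.2)
      ((volume.restrict (Set.Ioi 0)).prod (volume.restrict (Set.Ioi 0))) :=
  (measurable_durrKernel a b n).ennreal_toReal.aestronglyMeasurable.mul hf.comp_snd

/-- For the composition of the integral parts, absolute convergence follows from that of the
composed kernel. -/
lemma lintegral_durrKernel_mul_lintegral {a b : ℕ} (hab : a = 0 ∨ b = 0) {m n x : ℝ} {f : ℝ → ℝ}
    (hm : 0 < m) (hn : 0 < n) (hx : 0 ≤ x)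
    (hf : AEStronglyMeasurable f (volume.restrict (Set.Ioi 0))) :
    ∫⁻ y in Set.Ioi (0 : ℝ), durrKernel a b m x y *
        ∫⁻ t in Set.Ioi (0 : ℝ), durrKernel a b n y t * ‖f t‖ₑ =
      ∫⁻ t in Set.Ioi (0 : ℝ), durrKernel a b (m * n / (m + n)) x t * ‖f t‖ₑ := by
  have hkx := measurable_durrKernel_right a b m x
  have h1 : ∀ y, durrKernel a b m x y *
      ∫⁻ t in Set.Ioi (0 : ℝ), durrKernel a b n y t * ‖f t‖ₑ =
      ∫⁻ t in Set.Ioi (0 : ℝ), durrKernel a b m x y * (durrKernel a b n y t * ‖f t‖ₑ) := fun y =>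
    (lintegral_const_mul'' _ ((measurable_durrKernel_right a b n y).aemeasurable.mul hf.enorm)).symm
  simp_rw [h1]
  rw [lintegral_lintegral_swap]
  · refine setLIntegral_congr_fun measurableSet_Ioi fun t ht => ?_
    simp_rw [← mul_assoc]
    rw [lintegral_mul_const _ (hkx.fun_mul (measurable_durrKernel_left a b n t)),
      lintegral_durrKernel_mul_durrKernel hab hm hn hx (le_of_lt ht)]
  · exact (hkx.comp measurable_fst).aemeasurable.mul
      ((measurable_durrKernel a b n).aemeasurable.mul hf.comp_snd.enorm)

/-- The integral parts of the Durrmeyer operators compose like the operators themselves. -/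
lemma durrPart_comp {a b : ℕ} (hab : a = 0 ∨ b = 0) {m n x : ℝ} {f g : ℝ → ℝ}
    (hm : 0 < m) (hn : 0 < n) (hx : 0 ≤ x)
    (hf : AEStronglyMeasurable f (volume.restrict (Set.Ioi 0)))
    (hfn : ∀ y ≥ 0, ∫⁻ t in Set.Ioi (0 : ℝ), durrKernel a b n y t * ‖f t‖ₑ ≠ ∞)
    (hfr : ∫⁻ t in Set.Ioi (0 : ℝ), durrKernel a b (m * n / (m + n)) x t * ‖f t‖ₑ ≠ ∞)
    (hg : ∀ y > 0, g y = durrPart a b n f y) :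
    AEStronglyMeasurable g (volume.restrict (Set.Ioi 0)) ∧
      ∫⁻ y in Set.Ioi (0 : ℝ), durrKernel a b m x y * ‖g y‖ₑ ≠ ∞ ∧
      durrPart a b m g x = durrPart a b (m * n / (m + n)) f x := by
  have hmn : 0 ≤ m * n / (m + n) := by positivity
  have hgi : ∀ y ∈ Set.Ioi (0 : ℝ),
      g y = ∫ t in Set.Ioi (0 : ℝ), (durrKernel a b n y t).toReal * f t := fun y hy => by
    rw [hg y hy, durrPart_eq_integral hn.le (le_of_lt hy) hf (hfn y (le_of_lt hy))]
  have hgm : AEStronglyMeasurable g (volume.restrict (Set.Ioi 0)) := by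
    refine (aestronglyMeasurable_durrKernel_mul a b n hf).integral_prod_right'.congr ?_
    filter_upwards [ae_restrict_mem measurableSet_Ioi] with y hy
    exact (hgi y hy).symm
  have hcomp := lintegral_durrKernel_mul_lintegral hab hm hn hx hf
  have hgfin : ∫⁻ y in Set.Ioi (0 : ℝ), durrKernel a b m x y * ‖g y‖ₑ ≠ ∞ := by
    refine ne_top_of_le_ne_top hfr ?_
    rw [← hcomp]
    refine setLIntegral_mono' measurableSet_Ioi fun y hy => mul_le_mul_right ?_ _
    rw [hgi y hy]
    refine (enorm_integral_le_lintegral_enorm _).trans_eq ?_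
    exact setLIntegral_congr_fun measurableSet_Ioi fun t ht =>
      enorm_toReal_durrKernel_mul a b hn.le (le_of_lt hy) (le_of_lt ht) (f t)
  refine ⟨hgm, hgfin, ?_⟩
  rw [durrPart_eq_integral hm.le hx hgm hgfin, durrPart_eq_integral hmn hx hf hfr,
    setIntegral_congr_fun measurableSet_Ioi fun y hy => by rw [hgi y hy, ← integral_const_mul]]
  have hkx := measurable_durrKernel_right a b m x
  have hmeas : AEStronglyMeasurable (Function.uncurry fun y t => (durrKernel a b m x y).toReal *
      ((durrKernel a b n y t).toReal * f t))
      ((volume.restrict (Set.Ioi (0 : ℝ))).prod (volume.restrict (Set.Ioi (0 : ℝ)))) :=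
    (hkx.comp measurable_fst).ennreal_toReal.aestronglyMeasurable.mul
      (aestronglyMeasurable_durrKernel_mul a b n hf)
  rw [integral_integral_swap]
  · refine setIntegral_congr_fun measurableSet_Ioi fun t ht => ?_
    simp_rw [← mul_assoc]
    rw [integral_mul_const]
    congr 1
    rw [← lintegral_durrKernel_mul_durrKernel hab hm hn hx (le_of_lt ht)]
    simp_rw [← ENNReal.toReal_mul]
    refine integral_toReal ?_ ?_
    · exact (hkx.mul (measurable_durrKernel_left a b n t)).aemeasurable
    · filter_upwards [ae_restrict_mem measurableSet_Ioi] with y hy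
      exact ENNReal.mul_lt_top (durrKernel_ne_top a b hm.le hx (le_of_lt hy)).lt_top
        (durrKernel_ne_top a b hn.le (le_of_lt hy) (le_of_lt ht)).lt_top
  · refine ⟨hmeas, ?_⟩
    rw [hasFiniteIntegral_iff_enorm, lintegral_prod _ hmeas.enorm]
    refine lt_of_eq_of_lt ?_ hfr.lt_top
    rw [← hcomp]
    refine setLIntegral_congr_fun measurableSet_Ioi fun y hy => ?_
    simp only [Function.uncurry_apply_pair]
    rw [← lintegral_const_mul' _ _ (durrKernel_ne_top a b hm.le hx (le_of_lt hy))]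
    refine setLIntegral_congr_fun measurableSet_Ioi fun t ht => ?_
    rw [enorm_toReal_durrKernel_mul a b hm.le hx (le_of_lt hy),
      enorm_toReal_durrKernel_mul a b hn.le (le_of_lt hy) (le_of_lt ht)]

lemma Snj_eq_durrPart (n : ℝ) (j : ℤ) (f : ℝ → ℝ) (x : ℝ) :
    Snj n j f x = f 0 * ∑ k ∈ Finset.range j.toNat, poissonWeight k (n * x) +
      durrPart j.toNat (-j).toNat n f x := by
  have h1 : ∀ k : ℕ, max 0 j + (k : ℤ) = ((j.toNat + k : ℕ) : ℤ) := fun k => by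
    push_cast; omega
  have h2 : ∀ k : ℕ, max 0 j + (k : ℤ) - j = (((-j).toNat + k : ℕ) : ℤ) := fun k => by
    push_cast; omega
  simp only [Snj, durrPart, h2, szk_natCast]
  simp only [h1, szk_natCast]

lemma durrPart_one (a : ℕ) {n : ℝ} (hn : 0 < n) (x : ℝ) :
    ∑ k ∈ Finset.range a, poissonWeight k (n * x) + durrPart a 0 n (fun _ => 1) x = 1 := by
  have h : ∀ i : ℕ, n * ∫ t in Set.Ioi (0 : ℝ), poissonWeight i (n * t) = 1 := by
    intro i
    have := lintegral_poissonWeight_mul_exp i (A := 0) hn.le hn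
    rw [integral_eq_lintegral_of_nonneg_ae]
    · simp only [zero_mul, Real.exp_zero, mul_one, sub_zero] at this
      rw [this, ENNReal.toReal_ofReal (by positivity), pow_succ]
      field_simp
    · filter_upwards [ae_restrict_mem measurableSet_Ioi] with t ht
      simpa using poissonWeight_nonneg _ (mul_nonneg hn.le (le_of_lt ht))
    · exact Measurable.aestronglyMeasurable (by fun_prop)
  simp only [durrPart, zero_add, mul_one, h]
  have hs := hasSum_poissonWeight (n * x)
  rw [← hs.tsum_eq, ← hs.summable.sum_add_tsum_nat_add a]
  simp only [add_comm]

lemma durrPart_zero_right {a : ℕ} (ha : 0 < a) (b : ℕ) (n : ℝ) (f : ℝ → ℝ) :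
    durrPart a b n f 0 = 0 := by
  simp [durrPart, poissonWeight, ha.ne']

/-- For `j > 0`, subtracting the value at `0` turns the Durrmeyer operator into its integral
part. -/
lemma Snj_eq_add_durrPart {n x : ℝ} {j : ℤ} {f g : ℝ → ℝ} (hj : 0 < j) (hn : 0 < n) (hx : 0 ≤ x)
    (hg : AEStronglyMeasurable g (volume.restrict (Set.Ioi 0)))
    (hfin : ∫⁻ t in Set.Ioi (0 : ℝ), durrKernel j.toNat (-j).toNat n x t * ‖g t‖ₑ ≠ ∞)
    (hfg : ∀ t > 0, f t = f 0 + g t) :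
    Snj n j f x = f 0 + durrPart j.toNat (-j).toNat n g x := by
  have hb : (-j).toNat = 0 := by omega
  rw [Snj_eq_durrPart, hb]
  rw [hb] at hfin
  set a := j.toNat
  have hc : ∫⁻ t in Set.Ioi (0 : ℝ), durrKernel a 0 n x t * ‖f 0‖ₑ ≠ ∞ :=
    lintegral_durrKernel_mul_enorm_ne_top a 0 (f := fun _ => f 0) (A := 0) (K := |f 0|) hn.le hx hn
      (by simp)
  have h1 : ∫⁻ t in Set.Ioi (0 : ℝ), durrKernel a 0 n x t * ‖(1 : ℝ)‖ₑ ≠ ∞ :=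
    lintegral_durrKernel_mul_enorm_ne_top a 0 (f := fun _ => 1) (A := 0) (K := 1) hn.le hx hn
      (by simp)
  have hIc := integrable_durrKernel_mul hn.le hx aestronglyMeasurable_const hc
  have hIg := integrable_durrKernel_mul hn.le hx hg hfin
  have hfin' : ∫⁻ t in Set.Ioi (0 : ℝ), durrKernel a 0 n x t * ‖f 0 + g t‖ₑ ≠ ∞ := by
    have := (hIc.add hIg).hasFiniteIntegral
    rw [hasFiniteIntegral_iff_enorm] at this
    refine ne_top_of_le_ne_top this.ne (le_of_eq ?_)
    refine setLIntegral_congr_fun measurableSet_Ioi fun t ht => ?_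
    simp only [Pi.add_apply]
    rw [← mul_add, enorm_toReal_durrKernel_mul a 0 hn.le hx (le_of_lt ht)]
  have hsplit : durrPart a 0 n f x = f 0 * durrPart a 0 n (fun _ => 1) x + durrPart a 0 n g x := by
    rw [durrPart_congr a 0 n x hfg,
      durrPart_eq_integral (f := fun t => f 0 + g t) hn.le hx
        (aestronglyMeasurable_const.add hg) hfin',
      durrPart_eq_integral hn.le hx hg hfin,
      durrPart_eq_integral hn.le hx aestronglyMeasurable_const h1, ← integral_const_mul,
      ← integral_add ?_ hIg]
    · congr 1; funext t; ring
    · exact hIc.congr_fun (fun t _ => by ring) measurableSet_Ioi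
  rw [hsplit]
  linear_combination f 0 * durrPart_one a hn x

/-- Composition formula: `S_{m,j}(S_{n,j} f) = S_{mn/(m+n),j} f` on `[0,∞)`. -/
theorem composition_Snj (j : ℤ) (A : ℝ) (hA : 0 ≤ A) (f : ℝ → ℝ) (hf : MemEA A f)
    (n m : ℝ) (hn : n > A) (hm : m > A * n / (n - A)) :
    ∀ x ≥ (0:ℝ), Snj m j (Snj n j f) x = Snj (m * n / (m + n)) j f x := by
  intro x hx
  obtain ⟨hloc, K, hK, hfK⟩ := hf
  have hn0 : 0 < n := hA.trans_lt hn
  have hnA : 0 < n - A := sub_pos.2 hn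
  have hm0 : 0 < m := lt_of_le_of_lt (by positivity) hm
  have hr0 : 0 < m * n / (m + n) := by positivity
  have hr : A < m * n / (m + n) := by
    rw [gt_iff_lt, div_lt_iff₀ hnA] at hm
    rw [lt_div_iff₀ (by positivity)]
    linarith
  have hfm : AEStronglyMeasurable f (volume.restrict (Set.Ioi 0)) :=
    hloc.aestronglyMeasurable.mono_set Set.Ioi_subset_Ici_self
  have hab : j.toNat = 0 ∨ (-j).toNat = 0 := by omega
  rcases le_or_gt j 0 with hj | hj
  · have hS : ∀ (l : ℝ) (g : ℝ → ℝ) (y : ℝ),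
        Snj l j g y = durrPart j.toNat (-j).toNat l g y := fun l g y => by
      rw [Snj_eq_durrPart, Int.toNat_of_nonpos hj]
      simp
    rw [hS, hS]
    exact (durrPart_comp hab hm0 hn0 hx hfm
      (fun y hy => lintegral_durrKernel_mul_enorm_ne_top _ _ hn0.le hy hn hfK)
      (lintegral_durrKernel_mul_enorm_ne_top _ _ hr0.le hx hr hfK) fun y _ => hS n f y).2.2
  · set g : ℝ → ℝ := fun t => f t - f 0
    have hgm : AEStronglyMeasurable g (volume.restrict (Set.Ioi 0)) :=
      hfm.sub aestronglyMeasurable_const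
    have hgK : ∀ t ≥ (0 : ℝ), |g t| ≤ (K + |f 0|) * Real.exp (A * t) := fun t ht => by
      have h1 : |f 0| ≤ |f 0| * Real.exp (A * t) :=
        le_mul_of_one_le_right (abs_nonneg _) (Real.one_le_exp (mul_nonneg hA ht))
      have h2 := abs_sub (f t) (f 0)
      have h3 := hfK t ht
      simp only [g]
      linarith
    have hgn := fun y (hy : y ≥ 0) =>
      lintegral_durrKernel_mul_enorm_ne_top j.toNat (-j).toNat hn0.le hy hn hgK
    have hgr := lintegral_durrKernel_mul_enorm_ne_top j.toNat (-j).toNat hr0.le hx hr hgK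
    have hfg : ∀ t > 0, f t = f 0 + g t := fun t _ => by simp [g]
    have hSn : ∀ y ≥ 0, Snj n j f y = f 0 + durrPart j.toNat (-j).toNat n g y := fun y hy =>
      Snj_eq_add_durrPart hj hn0 hy hgm (hgn y hy) hfg
    have hS0 : Snj n j f 0 = f 0 := by
      rw [hSn 0 le_rfl, durrPart_zero_right (by omega), add_zero]
    obtain ⟨hm1, hm2, hm3⟩ := durrPart_comp hab hm0 hn0 hx hgm hgn hgr fun y _ => rfl
    rw [Snj_eq_add_durrPart hj hm0 hx hm1 hm2 fun t ht => by rw [hS0, hSn t (le_of_lt ht)],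
      Snj_eq_add_durrPart hj hr0 hx hgm hgr hfg, hS0, hm3]
end

section
/- Let j ∈ ℤ with j ≤ 1, l ∈ ℕ, A > 0, n > A, and let f : [0,∞) → ℝ be l-times differentiable with f^{(l)} ∈ E_A. Then the l-th derivative of S_{n,j} f equals S_{n,j−l} applied to the l-th derivative of f: (S_{n,j} f)^{(l)} = S_{n, j−l} f^{(l)} on [0,∞). -/
open MeasureTheory Real Filter Asymptotics

/-- `szk` at a natural index. -/
theorem szk_natCast_s5 (n : ℝ) (p : ℕ) (x : ℝ) :
    szk n p x = (n * x) ^ p / p.factorial * Real.exp (-n * x) := by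
  simp [szk]

theorem hasDerivAt_szk_zero (n x : ℝ) : HasDerivAt (szk n 0) (-n * szk n 0 x) x := by
  have h : szk n 0 = fun x => Real.exp (-n * x) := by
    funext y
    simp [szk]
  rw [h]
  have := ((hasDerivAt_id x).const_mul (-n)).exp
  simpa [mul_comm] using this

theorem hasDerivAt_szk_succ (n : ℝ) (p : ℕ) (x : ℝ) :
    HasDerivAt (szk n (p + 1)) (n * (szk n p x - szk n (p + 1) x)) x := by
  have h : szk n (p + 1) =
      fun x => (n * x) ^ (p + 1) / (p + 1).factorial * Real.exp (-n * x) := by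
    funext y
    exact_mod_cast szk_natCast_s5 n (p + 1) y
  rw [h, szk_natCast_s5]
  have h1 := ((hasDerivAt_id x).const_mul (-n)).exp
  have h2 := (((hasDerivAt_id x).const_mul n).pow (p + 1)).div_const ((p + 1).factorial : ℝ)
  refine (h2.mul h1).congr_deriv ?_
  have : (p.factorial : ℝ) ≠ 0 := by positivity
  simp only [id, Nat.factorial_succ, Nat.cast_mul, Nat.cast_add, Nat.cast_one,
    Nat.add_sub_cancel, Pi.pow_apply]
  field_simp
  ring

theorem differentiable_szk (n : ℝ) (p : ℕ) : Differentiable ℝ (szk n p) := by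
  intro x
  rcases p with _ | p
  · exact_mod_cast (hasDerivAt_szk_zero n x).differentiableAt
  · exact_mod_cast (hasDerivAt_szk_succ n p x).differentiableAt

theorem szk_zero_right (n : ℝ) (p : ℕ) : szk n p 0 = if p = 0 then 1 else 0 := by
  rw [szk_natCast_s5]
  by_cases hp : p = 0 <;> simp [hp]

theorem abs_szk_mul_le {A n K : ℝ} (hA : 0 ≤ A) (hn : A < n) {y t : ℝ} (ht : 0 ≤ t)
    (hy : |y| ≤ K * Real.exp (A * t)) (p : ℕ) :
    |szk n p t * y| ≤
      K * (n / ((n - A) / 2)) ^ p * Real.exp (-((n - A) / 2) * t) := by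
  set c := (n - A) / 2 with hc
  have hc0 : 0 < c := by rw [hc]; linarith
  have hn0 : 0 < n := by linarith
  have hs : szk n p t ≤ (n / c) ^ p * Real.exp (c * t) * Real.exp (-n * t) := by
    rw [szk_natCast_s5]
    have h := Real.pow_div_factorial_le_exp (c * t) (by positivity) p
    calc (n * t) ^ p / p.factorial * Real.exp (-n * t)
        = (n / c) ^ p * ((c * t) ^ p / p.factorial) * Real.exp (-n * t) := by
          rw [← mul_div_assoc, ← mul_pow, show n / c * (c * t) = n * t by field_simp]
      _ ≤ _ := by gcongr
  have hs0 : 0 ≤ szk n p t := by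
    rw [szk_natCast_s5]
    positivity
  rw [abs_mul, abs_of_nonneg hs0]
  calc szk n p t * |y| ≤ ((n / c) ^ p * Real.exp (c * t) * Real.exp (-n * t)) *
        (K * Real.exp (A * t)) := by gcongr
    _ = K * (n / c) ^ p * Real.exp (c * t + -n * t + A * t) := by
      rw [Real.exp_add, Real.exp_add]; ring
    _ = _ := by
      congr 2
      rw [hc]; ring

theorem MemEA.integrableOn_szk_mul {A n : ℝ} {f : ℝ → ℝ} (hf : MemEA A f) (hA : 0 ≤ A)
    (hn : A < n) (p : ℕ) : IntegrableOn (fun t => szk n p t * f t) (Set.Ioi 0) := by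
  obtain ⟨hloc, K, hK, hb⟩ := hf
  have hc0 : 0 < (n - A) / 2 := by linarith
  refine Integrable.mono' ((exp_neg_integrableOn_Ioi 0 hc0).const_mul
    (K * (n / ((n - A) / 2)) ^ p)) ?_ ?_
  · exact (differentiable_szk n p).continuous.aestronglyMeasurable.mul
      (hloc.aestronglyMeasurable.mono_set Set.Ioi_subset_Ici_self)
  · filter_upwards [ae_restrict_mem measurableSet_Ioi] with t ht
    exact abs_szk_mul_le hA hn (le_of_lt ht) (hb t (le_of_lt ht)) p

theorem MemEA.tendsto_szk_mul {A n : ℝ} {f : ℝ → ℝ} (hf : MemEA A f) (hA : 0 ≤ A)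
    (hn : A < n) (p : ℕ) : Tendsto (fun t => szk n p t * f t) atTop (nhds 0) := by
  obtain ⟨-, K, hK, hb⟩ := hf
  have hc0 : 0 < (n - A) / 2 := by linarith
  refine squeeze_zero_norm' (a := fun t =>
    K * (n / ((n - A) / 2)) ^ p * Real.exp (-((n - A) / 2) * t)) ?_ ?_
  · filter_upwards [eventually_ge_atTop 0] with t ht
    exact abs_szk_mul_le hA hn ht (hb t ht) p
  · rw [← mul_zero (K * (n / ((n - A) / 2)) ^ p)]
    refine Tendsto.const_mul _ (Real.tendsto_exp_atBot.comp ?_)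
    exact tendsto_id.const_mul_atTop_of_neg (by linarith)

theorem MemEA.exists_abs_integral_szk_mul_le {A n : ℝ} {f : ℝ → ℝ} (hf : MemEA A f)
    (hA : 0 ≤ A) (hn : A < n) :
    ∃ C ≥ 0, ∃ r ≥ 1, ∀ p : ℕ, |∫ t in Set.Ioi (0 : ℝ), szk n p t * f t| ≤ C * r ^ p := by
  obtain ⟨hloc, K, hK, hb⟩ := hf
  have hc0 : 0 < (n - A) / 2 := by linarith
  refine ⟨K * ∫ t in Set.Ioi (0 : ℝ), Real.exp (-((n - A) / 2) * t), by positivity,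
    n / ((n - A) / 2), ?_, fun p => ?_⟩
  · rw [ge_iff_le, le_div_iff₀ hc0]; linarith
  · have hi := (exp_neg_integrableOn_Ioi 0 hc0).const_mul (K * (n / ((n - A) / 2)) ^ p)
    refine (norm_integral_le_of_norm_le (f := fun t => szk n p t * f t) hi ?_).trans_eq ?_
    · filter_upwards [ae_restrict_mem measurableSet_Ioi] with t ht
      exact abs_szk_mul_le hA hn (le_of_lt ht) (hb t (le_of_lt ht)) p
    · rw [integral_const_mul]; ring

/-- The space `E_A` with `A > 0` is closed under taking antiderivatives. -/
theorem MemEA.of_deriv {A : ℝ} (hA : 0 < A) {f : ℝ → ℝ} (hd : Differentiable ℝ f)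
    (hf : MemEA A (deriv f)) : MemEA A f := by
  obtain ⟨-, K, hK, hb⟩ := hf
  refine ⟨(hd.continuous.locallyIntegrable).locallyIntegrableOn _, |f 0| + K / A,
    by positivity, fun t ht => ?_⟩
  have key := image_norm_le_of_norm_deriv_right_le_deriv_boundary (f := f) (f' := deriv f)
    (a := 0) (b := t) (B := fun s => |f 0| + K / A * (Real.exp (A * s) - 1))
    (B' := fun s => K * Real.exp (A * s)) hd.continuous.continuousOn
    (fun s _ => (hd s).hasDerivAt.hasDerivWithinAt) (by simp) (fun s => ?_)
    (fun s hs => hb s hs.1) (Set.right_mem_Icc.2 ht)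
  · have h1 : 1 ≤ Real.exp (A * t) := Real.one_le_exp (by positivity)
    have h2 : 0 ≤ K / A := by positivity
    rw [Real.norm_eq_abs] at key
    nlinarith [abs_nonneg (f 0)]
  · have h1 := ((hasDerivAt_id s).const_mul A).exp
    refine (((h1.sub_const 1).const_mul (K / A)).const_add (|f 0|)).congr_deriv ?_
    simp
    field_simp

theorem MemEA.of_iteratedDeriv {A : ℝ} (hA : 0 < A) (l : ℕ) {f : ℝ → ℝ}
    (hdiff : ∀ i < l, Differentiable ℝ (iteratedDeriv i f))
    (hf : MemEA A (iteratedDeriv l f)) : MemEA A f := by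
  induction l with
  | zero => simpa using hf
  | succ l ih =>
    refine ih (fun i hi => hdiff i (by omega)) (.of_deriv hA (hdiff l (by omega)) ?_)
    rwa [← iteratedDeriv_succ]

theorem integral_szk_zero_mul_deriv {A n : ℝ} (hA : 0 ≤ A) (hn : A < n) {f : ℝ → ℝ}
    (hd : Differentiable ℝ f) (hf : MemEA A f) (hf' : MemEA A (deriv f)) :
    ∫ t in Set.Ioi (0 : ℝ), szk n 0 t * deriv f t =
      n * (∫ t in Set.Ioi (0 : ℝ), szk n 0 t * f t) - f 0 := by
  have h0 := hf.integrableOn_szk_mul hA hn 0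
  have h0' := hf'.integrableOn_szk_mul hA hn 0
  have ht := hf.tendsto_szk_mul hA hn 0
  have hz := szk_zero_right n 0
  simp only [Nat.cast_zero, if_true] at h0 h0' ht hz
  have key := integral_Ioi_of_hasDerivAt_of_tendsto' (a := 0)
    (f := fun t => szk n 0 t * f t)
    (f' := fun t => -n * (szk n 0 t * f t) + szk n 0 t * deriv f t)
    (fun t _ => ((hasDerivAt_szk_zero n t).mul (hd t).hasDerivAt).congr_deriv (by ring))
    ((h0.const_mul (-n)).add h0') ht
  rw [integral_add (h0.const_mul (-n)) h0', integral_const_mul, hz] at key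
  linarith

theorem integral_szk_succ_mul_deriv {A n : ℝ} (hA : 0 ≤ A) (hn : A < n) {f : ℝ → ℝ}
    (hd : Differentiable ℝ f) (hf : MemEA A f) (hf' : MemEA A (deriv f)) (p : ℕ) :
    ∫ t in Set.Ioi (0 : ℝ), szk n (p + 1) t * deriv f t =
      n * (∫ t in Set.Ioi (0 : ℝ), szk n (p + 1) t * f t) -
        n * ∫ t in Set.Ioi (0 : ℝ), szk n p t * f t := by
  have h0 := hf.integrableOn_szk_mul hA hn p
  have h1 := hf.integrableOn_szk_mul hA hn (p + 1)
  have h1' := hf'.integrableOn_szk_mul hA hn (p + 1)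
  have ht := hf.tendsto_szk_mul hA hn (p + 1)
  have hz := szk_zero_right n (p + 1)
  simp only [Nat.cast_add, Nat.cast_one, Nat.succ_ne_zero, if_false] at h1 h1' ht hz
  have key := integral_Ioi_of_hasDerivAt_of_tendsto' (a := 0)
    (f := fun t => szk n (p + 1) t * f t)
    (f' := fun t => n * (szk n p t * f t) - n * (szk n (p + 1) t * f t) +
      szk n (p + 1) t * deriv f t)
    (fun t _ => ((hasDerivAt_szk_succ n p t).mul (hd t).hasDerivAt).congr_deriv (by ring))
    (((h0.const_mul n).sub (h1.const_mul n)).add h1') ht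
  have h01 : IntegrableOn (fun t => n * (szk n p t * f t) - n * (szk n (p + 1) t * f t))
      (Set.Ioi 0) := (h0.const_mul n).sub (h1.const_mul n)
  rw [integral_add h01 h1',
    integral_sub (h0.const_mul n) (h1.const_mul n), integral_const_mul, integral_const_mul,
    hz] at key
  linarith

theorem summable_pow_div_factorial_mul {b : ℕ → ℝ} {C r : ℝ}
    (hb : ∀ k, |b k| ≤ C * r ^ k) (y : ℝ) :
    Summable fun k : ℕ => y ^ k / k.factorial * b k := by
  refine Summable.of_norm_bounded (g := fun k : ℕ => C * ((|y| * r) ^ k / k.factorial))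
    ((Real.summable_pow_div_factorial _).mul_left _) fun k => ?_
  rw [norm_mul, norm_div, norm_pow, Real.norm_eq_abs, Real.norm_eq_abs, Real.norm_eq_abs,
    Nat.abs_cast, mul_pow]
  calc _ ≤ |y| ^ k / k.factorial * (C * r ^ k) := by
        gcongr; exact hb k
    _ = _ := by ring

theorem hasDerivAt_tsum_pow_div_factorial_mul {b : ℕ → ℝ} {C r : ℝ}
    (hb : ∀ k, |b k| ≤ C * r ^ k) (x : ℝ) :
    HasDerivAt (fun y => ∑' k : ℕ, y ^ k / k.factorial * b k)
      (∑' k : ℕ, x ^ k / k.factorial * b (k + 1)) x := by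
  have hb' : ∀ k, |b (k + 1)| ≤ C * r * r ^ k := fun k => (hb (k + 1)).trans_eq (by ring)
  have e (y : ℝ) (k : ℕ) : ((k + 1 : ℕ) * y ^ (k + 1 - 1)) / (k + 1).factorial * b (k + 1)
      = y ^ k / k.factorial * b (k + 1) := by
    have hk : (k.factorial : ℝ) ≠ 0 := by positivity
    rw [Nat.factorial_succ]
    push_cast
    field_simp
  have hR : 0 < |x| + 1 := by positivity
  have hG : HasDerivAt (fun y => ∑' k : ℕ, y ^ k / k.factorial * b k)
      (∑' k : ℕ, (k * x ^ (k - 1)) / k.factorial * b k) x := by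
    refine hasDerivAt_tsum_of_isPreconnected (t := Metric.ball (0 : ℝ) (|x| + 1)) (y₀ := 0)
      (g := fun (k : ℕ) (y : ℝ) => y ^ k / k.factorial * b k)
      (g' := fun (k : ℕ) (y : ℝ) => (k * y ^ (k - 1)) / k.factorial * b k)
      (u := fun k : ℕ => C * r * (((|x| + 1) * r) ^ (k - 1) / (k - 1).factorial))
      ?_ Metric.isOpen_ball (convex_ball _ _).isPreconnected
      (fun k y _ => ((hasDerivAt_pow k y).div_const _).mul_const (b k))
      (fun k y hy => ?_) (Metric.mem_ball_self hR)
      (summable_pow_div_factorial_mul hb 0) (by simp)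
    · rw [← summable_nat_add_iff 1]
      exact (Real.summable_pow_div_factorial _).mul_left _
    · rcases k with _ | k
      · simpa using (abs_nonneg _).trans (hb' 0)
      · have hy' : |y| ≤ |x| + 1 := by simpa using (Metric.mem_ball.1 hy).le
        rw [e, norm_mul, norm_div, norm_pow]
        simp only [Real.norm_eq_abs, Nat.abs_cast, Nat.add_sub_cancel]
        calc _ ≤ (|x| + 1) ^ k / k.factorial * (C * r * r ^ k) := by
              gcongr; exact hb' k
          _ = _ := by rw [mul_pow (|x| + 1) r]; ring
  refine hG.congr_deriv ?_
  rw [Summable.tsum_eq_zero_add]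
  · simp only [e]
    simp
  · rw [← summable_nat_add_iff 1]
    simp only [e]
    exact summable_pow_div_factorial_mul hb' x

theorem szk_mul_eq (n x c : ℝ) (k : ℕ) :
    szk n k x * c = (n * x) ^ k / k.factorial * c * Real.exp (-n * x) := by
  rw [szk_natCast_s5]
  ring

/-- Termwise differentiation of a Szász-Mirakjan series with coefficients of geometric growth. -/
theorem hasDerivAt_tsum_szk_mul (n : ℝ) {b : ℕ → ℝ} {C r : ℝ}
    (hb : ∀ k, |b k| ≤ C * r ^ k) (x : ℝ) :
    HasDerivAt (fun y => ∑' k : ℕ, szk n k y * b k)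
      (∑' k : ℕ, szk n k x * (n * (b (k + 1) - b k))) x := by
  have hb' : ∀ k, |b (k + 1)| ≤ C * r * r ^ k := fun k => (hb (k + 1)).trans_eq (by ring)
  have hlin := (hasDerivAt_id x).const_mul n
  have hG := (hasDerivAt_tsum_pow_div_factorial_mul hb (n * x)).comp x hlin
  have hE := ((hasDerivAt_id x).const_mul (-n)).exp
  have hs := summable_pow_div_factorial_mul hb (n * x)
  have hs' := summable_pow_div_factorial_mul hb' (n * x)
  simp only [szk_mul_eq, tsum_mul_right]
  refine (hG.mul hE).congr_deriv ?_
  have : ∀ k : ℕ, (n * x) ^ k / k.factorial * (n * (b (k + 1) - b k)) =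
      n * ((n * x) ^ k / k.factorial * b (k + 1) - (n * x) ^ k / k.factorial * b k) :=
    fun k => by ring
  simp only [this, tsum_mul_left, hs'.tsum_sub hs, Function.comp_apply, id]
  ring

theorem Snj_of_nonpos (n : ℝ) (m : ℕ) (f : ℝ → ℝ) (x : ℝ) :
    Snj n (-m) f x =
      ∑' k : ℕ, szk n k x * (n * ∫ t in Set.Ioi (0 : ℝ), szk n (k + m : ℕ) t * f t) := by
  simp [Snj]

theorem MemEA.hasDerivAt_Snj_of_nonpos {A n : ℝ} (hA : 0 ≤ A) (hn : A < n) {f : ℝ → ℝ}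
    (hd : Differentiable ℝ f) (hf : MemEA A f) (hf' : MemEA A (deriv f)) (m : ℕ) (x : ℝ) :
    HasDerivAt (Snj n (-m) f) (Snj n (-(m + 1 : ℕ)) (deriv f) x) x := by
  obtain ⟨C, hC, r, hr, hb⟩ := hf.exists_abs_integral_szk_mul_le hA hn
  rw [funext (Snj_of_nonpos n m f), Snj_of_nonpos]
  refine (hasDerivAt_tsum_szk_mul n (C := |n| * C * r ^ m) (r := r) (fun k => ?_)
    x).congr_deriv (tsum_congr fun k => ?_)
  · rw [abs_mul]
    calc _ ≤ |n| * (C * r ^ (k + m)) := by gcongr; exact hb _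
      _ = _ := by ring
  · have := integral_szk_succ_mul_deriv hA hn hd hf hf' (k + m)
    push_cast at this ⊢
    rw [← add_assoc, this, add_right_comm]

/-- The coefficients of the Szász-Mirakjan series of `S_{n,1} f`. -/
noncomputable def snjOneCoeff (n : ℝ) (f : ℝ → ℝ) : ℕ → ℝ
  | 0 => f 0
  | p + 1 => n * ∫ t in Set.Ioi (0 : ℝ), szk n p t * f t

theorem abs_snjOneCoeff_le {n : ℝ} {f : ℝ → ℝ} {C r : ℝ} (hC : 0 ≤ C) (hr : 1 ≤ r)
    (hb : ∀ p : ℕ, |∫ t in Set.Ioi (0 : ℝ), szk n p t * f t| ≤ C * r ^ p) (k : ℕ) :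
    |snjOneCoeff n f k| ≤ (|f 0| + |n| * C) * r ^ k := by
  have hr0 : 0 ≤ r := by linarith
  rcases k with _ | k
  · simp only [snjOneCoeff, pow_zero, mul_one, le_add_iff_nonneg_right]
    positivity
  · have h1 : r ^ k ≤ r ^ (k + 1) := pow_le_pow_right₀ hr (by omega)
    rw [snjOneCoeff, abs_mul]
    calc _ ≤ |n| * (C * r ^ (k + 1)) := by gcongr; exact (hb k).trans (by gcongr)
      _ ≤ |f 0| * r ^ (k + 1) + |n| * (C * r ^ (k + 1)) :=
        le_add_of_nonneg_left (by positivity)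
      _ = _ := by ring

theorem Snj_one {n : ℝ} {f : ℝ → ℝ} {C r : ℝ}
    (hb : ∀ k, |snjOneCoeff n f k| ≤ C * r ^ k) (x : ℝ) :
    Snj n 1 f x = ∑' k : ℕ, szk n k x * snjOneCoeff n f k := by
  rw [Summable.tsum_eq_zero_add]
  · simp [Snj, snjOneCoeff, mul_comm, add_comm]
  · simp only [szk_mul_eq]
    exact (summable_pow_div_factorial_mul hb (n * x)).mul_right _

theorem MemEA.hasDerivAt_Snj_one {A n : ℝ} (hA : 0 ≤ A) (hn : A < n) {f : ℝ → ℝ}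
    (hd : Differentiable ℝ f) (hf : MemEA A f) (hf' : MemEA A (deriv f)) (x : ℝ) :
    HasDerivAt (Snj n 1 f) (Snj n 0 (deriv f) x) x := by
  obtain ⟨C, hC, r, hr, hb⟩ := hf.exists_abs_integral_szk_mul_le hA hn
  have h0 := Snj_of_nonpos n 0 (deriv f) x
  simp only [Nat.cast_zero, neg_zero, Nat.add_zero] at h0
  have hb' := abs_snjOneCoeff_le hC hr hb
  rw [funext (Snj_one hb'), h0]
  refine (hasDerivAt_tsum_szk_mul n hb' x).congr_deriv (tsum_congr fun k => ?_)
  rcases k with _ | k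
  · simp [snjOneCoeff, integral_szk_zero_mul_deriv hA hn hd hf hf']
  · have := integral_szk_succ_mul_deriv hA hn hd hf hf' k
    simp only [snjOneCoeff]
    push_cast
    rw [this]

/-- Differentiating `S_{n,j} f` once lowers `j` by one and differentiates `f`. -/
theorem MemEA.deriv_Snj {A n : ℝ} (hA : 0 ≤ A) (hn : A < n) {f : ℝ → ℝ}
    (hd : Differentiable ℝ f) (hf : MemEA A f) (hf' : MemEA A (deriv f)) {j : ℤ} (hj : j ≤ 1) :
    deriv (Snj n j f) = Snj n (j - 1) (deriv f) := by
  funext x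
  rcases hj.eq_or_lt with rfl | hj
  · simpa using (hasDerivAt_Snj_one hA hn hd hf hf' x).deriv
  · obtain ⟨m, rfl⟩ : ∃ m : ℕ, j = -m := ⟨(-j).toNat, by omega⟩
    rw [(hasDerivAt_Snj_of_nonpos hA hn hd hf hf' m x).deriv]
    congr 1
    push_cast
    ring

/-- For `j ≤ 1` the identity `(S_{n,j} f)^{(l)} = S_{n,j-l} f^{(l)}` holds on `[0,∞)`. -/
theorem deriv_Snj_eq (j : ℤ) (hj : j ≤ 1) (l : ℕ) (A : ℝ) (hA : 0 < A) (n : ℝ) (hn : n > A)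
    (f : ℝ → ℝ) (hdiff : ∀ i < l, Differentiable ℝ (iteratedDeriv i f))
    (hf : MemEA A (iteratedDeriv l f)) :
    ∀ x ≥ (0:ℝ), iteratedDeriv l (Snj n j f) x = Snj n (j - l) (iteratedDeriv l f) x := by
  induction l generalizing j f with
  | zero => intro x _; simp
  | succ l ih =>
    intro x hx
    have hd : Differentiable ℝ f := by simpa using hdiff 0 (by omega)
    have hdiff' : ∀ i < l, Differentiable ℝ (iteratedDeriv i (deriv f)) := fun i hi => by
      rw [← iteratedDeriv_succ']
      exact hdiff (i + 1) (by omega)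
    rw [iteratedDeriv_succ'] at hf ⊢
    have hf' : MemEA A (deriv f) := .of_iteratedDeriv hA l hdiff' hf
    rw [iteratedDeriv_succ', MemEA.deriv_Snj hA.le hn hd (.of_deriv hA hd hf') hf' hj,
      ih (j - 1) (by omega) _ hdiff' hf x hx]
    congr 1
    push_cast
    ring
end

section
/- Let j ∈ ℤ and l ∈ ℕ. Then the differential operator D_j^{2l} equals the l-th iterate of D_j²: for every f that is 2l-times differentiable on (0,∞) and every x > 0, (D_j^{2l} f)(x) = ((D_j²)^l f)(x). -/
open MeasureTheory Real Filter Asymptotics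

/-- The differential operator `D_j² f = (1-j) f' + e₁ f''`. -/
noncomputable def D2 (j : ℤ) (f : ℝ → ℝ) (x : ℝ) : ℝ :=
  (1 - j) * deriv f x + x * deriv (deriv f) x

/-- The differential operator `D_j^{2l} f = e_j D^l (e_{l-j} D^l f)` on `(0,∞)`. -/
noncomputable def D2l (j : ℤ) (l : ℕ) (f : ℝ → ℝ) (x : ℝ) : ℝ :=
  x ^ j * iteratedDeriv l (fun t => t ^ ((l : ℤ) - j) * iteratedDeriv l f t) x

/-- Derivatives of `D_j² f`: `(D_j² f)^(i) = (i+1-j) f^(i+1) + e₁ f^(i+2)` on `(0,∞)`. -/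
theorem iteratedDeriv_D2 (j : ℤ) (f : ℝ → ℝ) (n : ℕ)
    (hdiff : ∀ i < n + 2, ∀ x > (0:ℝ), DifferentiableAt ℝ (iteratedDeriv i f) x) :
    ∀ i ≤ n, ∀ x > (0:ℝ), iteratedDeriv i (D2 j f) x =
      (i + 1 - j) * iteratedDeriv (i + 1) f x + x * iteratedDeriv (i + 2) f x := by
  intro i
  induction i with
  | zero =>
    intro _ x _
    simp [D2, iteratedDeriv_succ]
  | succ i ih =>
    intro hi x hx
    have hev : iteratedDeriv i (D2 j f) =ᶠ[nhds x] fun t =>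
        (i + 1 - j) * iteratedDeriv (i + 1) f t + t * iteratedDeriv (i + 2) f t := by
      filter_upwards [Ioi_mem_nhds hx] with t ht using ih (by omega) t ht
    have h1 := (hdiff (i + 1) (by omega) x hx).hasDerivAt
    have h2 := (hdiff (i + 2) (by omega) x hx).hasDerivAt
    rw [← iteratedDeriv_succ] at h1 h2
    rw [iteratedDeriv_succ, hev.deriv_eq]
    refine ((h1.const_mul ((i : ℝ) + 1 - j)).add ((hasDerivAt_id x).mul h2)).deriv.trans ?_
    push_cast
    simp only [id]
    ring

/-- `D_j^{2(l+1)} f = D_j^{2l} (D_j² f)` on `(0,∞)`. -/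
theorem D2l_succ (j : ℤ) (l : ℕ) (f : ℝ → ℝ)
    (hdiff : ∀ i < 2 * l + 2, ∀ x > (0:ℝ), DifferentiableAt ℝ (iteratedDeriv i f) x)
    (x : ℝ) (hx : 0 < x) : D2l j (l + 1) f x = D2l j l (D2 j f) x := by
  unfold D2l
  rw [iteratedDeriv_succ']
  congr 1
  apply Filter.EventuallyEq.iteratedDeriv_eq
  filter_upwards [Ioi_mem_nhds hx] with t ht
  have ht : 0 < t := ht
  have h1 := (hdiff (l + 1) (by omega) t ht).hasDerivAt
  rw [← iteratedDeriv_succ] at h1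
  refine ((hasDerivAt_zpow (((l + 1 : ℕ) : ℤ) - j) t (Or.inl ht.ne')).mul h1).deriv.trans ?_
  rw [iteratedDeriv_D2 j f (2 * l) hdiff l (by omega) t ht,
    show ((l + 1 : ℕ) : ℤ) - j - 1 = l - j by push_cast; ring,
    show ((l + 1 : ℕ) : ℤ) - j = (l - j) + 1 by push_cast; ring, zpow_add_one₀ ht.ne']
  push_cast
  ring

/-- `D_j^{2l}` is the `l`-th iterate of `D_j²`. -/
theorem D2l_eq_iterate (j : ℤ) (l : ℕ) (f : ℝ → ℝ)
    (hdiff : ∀ i < 2 * l, ∀ x > (0:ℝ), DifferentiableAt ℝ (iteratedDeriv i f) x) :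
    ∀ x > (0:ℝ), D2l j l f x = (D2 j)^[l] f x := by
  induction l generalizing f with
  | zero =>
    intro x hx
    simp [D2l, mul_inv_cancel_left₀ (zpow_ne_zero j hx.ne')]
  | succ l ih =>
    intro x hx
    rw [D2l_succ j l f hdiff x hx, Function.iterate_succ_apply]
    refine ih (D2 j f) (fun i hi y hy => ?_) x hx
    have h1 := hdiff (i + 1) (by omega) y hy
    have h2 := hdiff (i + 2) (by omega) y hy
    refine ((h1.const_mul ((i : ℝ) + 1 - j)).add
      (differentiableAt_id.mul h2)).congr_of_eventuallyEq ?_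
    filter_upwards [Ioi_mem_nhds hy] with t ht
    exact iteratedDeriv_D2 j f (2 * l) hdiff i hi.le t ht
end
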